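/- Let p = 2N+1 be odd squarefree with p ≡ 3 (mod 4), let J be the N×N matrix J_{k,x} = (2/√p)·sin(2πkx/p), and let ψ ∈ {-1,0,1}^N be the Jacobi-symbol vector ψ_x = χ(x). Let σ ∈ {-1,1}^N be any spin configuration agreeing with ψ wherever ψ_x ≠ 0, and let h = #{x : ψ_x = 0}. Then the energy E(σ) = -(1/2)·⟨σ, Jσ⟩ satisfies E(σ) ≤ -(N - h)/2 + h·√h. -/

import Mathlib

open Complex Filter Topology

/-- For real `z`, the theta function `jacobiTheta₂ z τ` tends to `1` as `im τ → ∞`. -/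
theorem tendsto_jacobiTheta₂_one {α : Type*} {l : Filter α} {τ : α → ℂ}
    (hτ : Tendsto (fun x => (τ x).im) l atTop) (z : ℝ) :
    Tendsto (fun x => jacobiTheta₂ z (τ x)) l (𝓝 1) := by
  have key : Tendsto (fun x => ∑' n : ℤ, jacobiTheta₂_term n z (τ x)) l
      (𝓝 (∑' n : ℤ, if n = 0 then (1 : ℂ) else 0)) := by
    refine tendsto_tsum_of_dominated_convergence
      (summable_pow_mul_jacobiTheta₂_term_bound 0 one_pos 0) (fun n => ?_) ?_
    · rcases eq_or_ne n 0 with rfl | hn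
      · simpa [jacobiTheta₂_term] using tendsto_const_nhds
      · rw [if_neg hn, tendsto_zero_iff_norm_tendsto_zero]
        simp only [norm_jacobiTheta₂_term, ofReal_im, mul_zero, sub_zero]
        refine Real.tendsto_exp_atBot.comp ?_
        have : (0 : ℝ) < (n : ℝ) ^ 2 := by positivity
        exact hτ.const_mul_atTop_of_neg (by nlinarith [Real.pi_pos])
    · filter_upwards [hτ.eventually_ge_atTop 1] with x hx n
      simpa using norm_jacobiTheta₂_term_le (S := 0) one_pos (z := (z : ℂ)) (by simp) hx n
  simpa [jacobiTheta₂] using key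

theorem real_mul_cpow_half {t : ℝ} (ht : 0 < t) {w : ℂ} (hw : w ≠ 0) :
    ((t : ℂ) * w) ^ (1 / 2 : ℂ) = √t * w ^ (1 / 2 : ℂ) := by
  have ht0 : (t : ℂ) ≠ 0 := by exact_mod_cast ht.ne'
  rw [cpow_def_of_ne_zero (mul_ne_zero ht0 hw), cpow_def_of_ne_zero hw, log_ofReal_mul ht hw,
    add_mul, Complex.exp_add, Real.sqrt_eq_rpow, Real.rpow_def_of_pos ht]
  push_cast
  rfl

/-- Poisson summation for the Gaussian along the residue class of `r` modulo `m`. -/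
theorem tsum_exp_neg_mul_sq_residueClass {w : ℂ} (hw : 0 < w.re) {m : ℕ} (hm : 0 < m) (r : ℝ) :
    ∑' j : ℤ, cexp (-Real.pi * w * (m * j + r) ^ 2) =
      1 / (m * w ^ (1 / 2 : ℂ)) * jacobiTheta₂ ((r / m : ℝ) : ℂ) (I / (m ^ 2 * w)) := by
  have hw0 : w ≠ 0 := by rintro rfl; simp at hw
  have hm0 : (m : ℂ) ≠ 0 := by exact_mod_cast hm.ne'
  have ha : 0 < (((m ^ 2 : ℝ) : ℂ) * w).re := by
    rw [re_ofReal_mul]; positivity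
  have hsqrt : (((m ^ 2 : ℝ) : ℂ) * w) ^ (1 / 2 : ℂ) = m * w ^ (1 / 2 : ℂ) := by
    rw [real_mul_cpow_half (by positivity) hw0, Real.sqrt_sq (by positivity), ofReal_natCast]
  have h := Complex.tsum_exp_neg_quadratic ha (-(w * m * r))
  rw [hsqrt] at h
  calc ∑' j : ℤ, cexp (-Real.pi * w * (m * j + r) ^ 2)
      = cexp (-Real.pi * w * r ^ 2) * ∑' j : ℤ, cexp (-Real.pi * ((m ^ 2 : ℝ) * w) * j ^ 2
          + 2 * Real.pi * (-(w * m * r)) * j) := by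
        rw [← tsum_mul_left]
        refine tsum_congr fun j => ?_
        rw [← Complex.exp_add]
        push_cast
        ring_nf
    _ = _ := by
        rw [h, mul_left_comm, ← tsum_mul_left, jacobiTheta₂]
        congr 1
        refine tsum_congr fun j => ?_
        rw [← Complex.exp_add, jacobiTheta₂_term]
        congr 1
        push_cast
        field_simp
        ring_nf
        simp only [I_sq]
        ring

/-- A Gaussian sum weighted by an `m`-periodic function is asymptotic to the mean of the function
divided by the square root of the Gaussian's parameter. -/
theorem tendsto_cpow_mul_tsum_periodic {α : Type*} {l : Filter α} {w : α → ℂ}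
    (hw : Tendsto (fun x => ((w x)⁻¹).re) l atTop) {m : ℕ} (hm : 0 < m) (f : ℤ → ℂ)
    (hf : ∀ j r : ℤ, f (m * j + r) = f r) :
    Tendsto (fun x => w x ^ (1 / 2 : ℂ) * ∑' n : ℤ, f n * cexp (-Real.pi * w x * n ^ 2)) l
      (𝓝 ((∑ r : Fin m, f r) / m)) := by
  have : NeZero m := ⟨hm.ne'⟩
  have hm0 : (m : ℂ) ≠ 0 := by exact_mod_cast hm.ne'
  have hlim : Tendsto (fun x => ∑ r : Fin m, f r / m *
      jacobiTheta₂ (((r : ℕ) / m : ℝ) : ℂ) (I / (m ^ 2 * w x))) l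
      (𝓝 (∑ r : Fin m, f r / m * 1)) := by
    refine tendsto_finsetSum _ fun r _ => Tendsto.const_mul _ ?_
    refine tendsto_jacobiTheta₂_one ?_ _
    have : ∀ x, (I / (m ^ 2 * w x)).im = ((m : ℝ) ^ 2)⁻¹ * ((w x)⁻¹).re := fun x => by
      have : I / (m ^ 2 * w x) = (((m : ℝ) ^ 2)⁻¹ : ℝ) * (I * (w x)⁻¹) := by
        push_cast; rw [div_eq_mul_inv, mul_inv]; ring
      rw [this, im_ofReal_mul]; simp
    simp_rw [this]
    exact hw.const_mul_atTop (by positivity)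
  rw [Finset.sum_div]
  simp only [mul_one] at hlim
  refine hlim.congr' ?_
  filter_upwards [hw.eventually_gt_atTop 0] with x hx
  have hw0 : w x ≠ 0 := by intro h; simp [h] at hx
  have hre : 0 < (w x).re := by
    rw [inv_re] at hx
    exact (div_pos_iff_of_pos_right (normSq_pos.mpr hw0)).mp hx
  have hsqrt0 : w x ^ (1 / 2 : ℂ) ≠ 0 := by simp [cpow_eq_zero_iff, hw0]
  have hbdd : ∃ C, ∀ n, ‖f n‖ ≤ C := by
    refine ⟨∑ r : Fin m, ‖f r‖, fun n => ?_⟩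
    have hr := (Int.divModEquiv m).symm_apply_apply n
    rw [Int.divModEquiv_symm_apply, mul_comm] at hr
    rw [← hr, hf]
    exact Finset.single_le_sum (f := fun r : Fin m => ‖f r‖) (fun _ _ => norm_nonneg _)
      (Finset.mem_univ _)
  obtain ⟨C, hC⟩ := hbdd
  have hsum : Summable fun n : ℤ => f n * cexp (-Real.pi * w x * n ^ 2) := by
    have h1 : Summable fun n : ℤ => cexp (-Real.pi * w x * n ^ 2) := by
      refine ((summable_jacobiTheta₂_term_iff 0 (I * w x)).mpr (by simpa using hre)).congr
        fun n => ?_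
      rw [jacobiTheta₂_term]
      congr 1
      ring_nf
      simp
    refine (h1.norm.mul_left C).of_norm_bounded fun n => ?_
    rw [norm_mul]
    gcongr
    exact hC n
  have hsplit : ∑' n : ℤ, f n * cexp (-Real.pi * w x * n ^ 2) =
      ∑ r : Fin m, f r * ∑' j : ℤ, cexp (-Real.pi * w x * (m * j + (r : ℕ)) ^ 2) := by
    have hs := (Int.divModEquiv m).symm.summable_iff.mpr hsum
    rw [← (Int.divModEquiv m).symm.tsum_eq, ← (Equiv.prodComm _ _).tsum_eq]
    refine (Summable.tsum_prod ((Equiv.prodComm _ _).summable_iff.mpr hs)).trans ?_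
    rw [tsum_fintype]
    refine Finset.sum_congr rfl fun r _ => ?_
    rw [← tsum_mul_left]
    refine tsum_congr fun j => ?_
    have := hf j (r : ℕ)
    rw [mul_comm] at this
    simp only [Function.comp_apply, Equiv.prodComm_apply, Prod.swap_prod_mk,
      Int.divModEquiv_symm_apply, this]
    push_cast
    ring_nf
  rw [hsplit, Finset.mul_sum]
  refine Finset.sum_congr rfl fun r _ => ?_
  have := tsum_exp_neg_mul_sq_residueClass hre hm (r : ℕ)
  push_cast at this ⊢
  rw [this]
  field_simp

theorem neg_I_cpow_half : (-I) ^ (1 / 2 : ℂ) = (1 - I) / √2 := by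
  have h2 : ((√2 : ℝ) : ℂ) ^ 2 = 2 := by exact_mod_cast Real.sq_sqrt (by norm_num : (0 : ℝ) ≤ 2)
  have h0 : ((√2 : ℝ) : ℂ) ≠ 0 := by simp
  rw [cpow_def_of_ne_zero (by simp), log_neg_I,
    show -(Real.pi / 2 : ℂ) * I * (1 / 2) = ((-(Real.pi / 4) : ℝ) : ℂ) * I by push_cast; ring,
    exp_mul_I, ← ofReal_cos, ← ofReal_sin, Real.cos_neg, Real.sin_neg, Real.cos_pi_div_four,
    Real.sin_pi_div_four]
  push_cast
  field_simp
  linear_combination (1 - I) * h2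

/-- The value of the quadratic Gauss sum, obtained by comparing the asymptotics of both sides of the
functional equation of the theta function near the cusp `2 / k`. -/
theorem sum_exp_sq {k : ℕ} (hk : 0 < k) :
    ∑ r : Fin k, cexp (2 * Real.pi * I * (r : ℕ) ^ 2 / k) =
      √k * ((1 + I) / 2) * (1 + (-I) ^ k) := by
  have hk0 : (k : ℂ) ≠ 0 := by exact_mod_cast hk.ne'
  set a : ℝ → ℂ := fun t => t - 2 * I / k with ha
  set w : ℝ → ℂ := fun t => t * (-(I * k) / (2 * a t)) with hw
  have ha_re : ∀ t, (a t).re = t := fun t => by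
    have : a t = t - ((2 / k : ℝ) : ℂ) * I := by simp only [ha]; push_cast; ring
    rw [this]; simp
  have ha0 : ∀ t, a t ≠ 0 := fun t h => by
    have : a t = t - ((2 / k : ℝ) : ℂ) * I := by simp only [ha]; push_cast; ring
    have := congrArg im (this.symm.trans h)
    simp at this
    omega
  have ha_lim : Tendsto a (𝓝[>] 0) (𝓝 (-(2 * I / k))) := by
    have : Continuous a := by fun_prop
    exact (by simpa [ha] using this.tendsto 0 : Tendsto a (𝓝 0) _).mono_left nhdsWithin_le_nhds
  have hq_lim : Tendsto (fun t => -(I * k) / (2 * a t)) (𝓝[>] 0) (𝓝 ((k ^ 2 / 4 : ℝ) : ℂ)) := by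
    have := (tendsto_const_nhds (x := -(I * k))).div (ha_lim.const_mul 2) (by simp [hk0])
    convert this using 1
    congr 1
    push_cast
    field_simp
    norm_num
  have hslit : ((k ^ 2 / 4 : ℝ) : ℂ) ∈ slitPlane := by
    rw [ofReal_mem_slitPlane]; positivity
  have hq_sqrt : Tendsto (fun t => (-(I * k) / (2 * a t)) ^ (1 / 2 : ℂ)) (𝓝[>] 0)
      (𝓝 (k / 2 : ℂ)) := by
    have := hq_lim.cpow (tendsto_const_nhds (x := (1 / 2 : ℂ))) hslit
    convert this using 2
    have h := real_mul_cpow_half (t := k ^ 2 / 4) (by positivity) (one_ne_zero (α := ℂ))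
    rw [one_cpow, mul_one, mul_one] at h
    rw [h, show (k ^ 2 / 4 : ℝ) = (k / 2) ^ 2 by ring, Real.sqrt_sq (by positivity)]
    push_cast
    rfl
  have ha_sqrt : Tendsto (fun t => a t ^ (1 / 2 : ℂ)) (𝓝[>] 0) (𝓝 ((1 - I) / √k)) := by
    have := ha_lim.cpow (tendsto_const_nhds (x := (1 / 2 : ℂ))) (by
      rw [mem_slitPlane_iff]
      right
      have : -(2 * I / k) = ((-(2 / k) : ℝ) : ℂ) * I := by push_cast; ring
      rw [this]
      simp
      omega)
    convert this using 2
    rw [show -(2 * I / k) = ((2 / k : ℝ) : ℂ) * (-I) by push_cast; ring,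
      real_mul_cpow_half (by positivity) (by simp), neg_I_cpow_half,
      Real.sqrt_div (by norm_num)]
    push_cast
    have h0 : ((√2 : ℝ) : ℂ) ≠ 0 := by simp
    field_simp
  have hinv : ∀ t : ℝ, 0 < t → (w t)⁻¹ = ((4 / k ^ 2 * t⁻¹ : ℝ) : ℂ) + ((2 / k : ℝ) : ℂ) * I := by
    intro t ht
    have ht0 : (t : ℂ) ≠ 0 := by exact_mod_cast ht.ne'
    simp only [hw, mul_inv, inv_div]
    simp only [ha]
    push_cast
    field_simp
    ring_nf
    simp only [I_sq]
    ring
  have hleft := tendsto_cpow_mul_tsum_periodic (l := 𝓝[>] (0 : ℝ)) (w := fun t => (t : ℂ))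
    (by simpa [← ofReal_inv] using tendsto_inv_nhdsGT_zero) hk
    (fun n => cexp (2 * Real.pi * I * n ^ 2 / k)) (by
      intro j r
      rw [Complex.exp_eq_exp_iff_exists_int]
      refine ⟨k * j ^ 2 + 2 * j * r, ?_⟩
      push_cast
      field_simp
      ring)
  have hright := tendsto_cpow_mul_tsum_periodic (l := 𝓝[>] (0 : ℝ)) (w := w) (by
      have h1 : Tendsto (fun t : ℝ => 4 / (k : ℝ) ^ 2 * t⁻¹) (𝓝[>] 0) atTop :=
        tendsto_inv_nhdsGT_zero.const_mul_atTop (by positivity)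
      refine h1.congr' ?_
      filter_upwards [self_mem_nhdsWithin] with t ht
      rw [hinv t ht, add_re, ofReal_re, re_ofReal_mul, I_re, mul_zero, add_zero]) two_pos
    (fun n => cexp (-Real.pi * (I * k / 2) * n ^ 2)) (by
      intro j r
      rw [Complex.exp_eq_exp_iff_exists_int]
      refine ⟨-(k * (j ^ 2 + j * r)), ?_⟩
      push_cast
      ring)
  have hfun : ∀ t : ℝ, 0 < t →
      (t : ℂ) ^ (1 / 2 : ℂ) * ∑' n : ℤ, cexp (2 * Real.pi * I * n ^ 2 / k) *
          cexp (-Real.pi * t * n ^ 2) =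
        (a t ^ (1 / 2 : ℂ))⁻¹ * ((-(I * k) / (2 * a t)) ^ (1 / 2 : ℂ))⁻¹ *
          (w t ^ (1 / 2 : ℂ) * ∑' n : ℤ, cexp (-Real.pi * (I * k / 2) * n ^ 2) *
            cexp (-Real.pi * w t * n ^ 2)) := by
    intro t ht
    have hq0 : -(I * k) / (2 * a t) ≠ 0 := by simp [hk0, ha0]
    have hq1 : (-(I * k) / (2 * a t)) ^ (1 / 2 : ℂ) ≠ 0 := by
      rw [Ne, cpow_eq_zero_iff]; simp [hq0]
    have hsqrt : w t ^ (1 / 2 : ℂ) = (t : ℂ) ^ (1 / 2 : ℂ) *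
        (-(I * k) / (2 * a t)) ^ (1 / 2 : ℂ) := by
      have h := real_mul_cpow_half ht (one_ne_zero (α := ℂ))
      rw [one_cpow, mul_one, mul_one] at h
      rw [h, hw, real_mul_cpow_half ht hq0]
    have hpoisson := Complex.tsum_exp_neg_mul_int_sq (a := a t) (by rwa [ha_re])
    have hl : ∀ n : ℤ, cexp (2 * Real.pi * I * n ^ 2 / k) * cexp (-Real.pi * t * n ^ 2) =
        cexp (-Real.pi * a t * n ^ 2) := fun n => by
      rw [← Complex.exp_add]; congr 1; simp only [ha]; ring
    have hr : ∀ n : ℤ, cexp (-Real.pi * (I * k / 2) * n ^ 2) * cexp (-Real.pi * w t * n ^ 2) =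
        cexp (-Real.pi / a t * n ^ 2) := fun n => by
      have : (a t)⁻¹ = I * k / 2 + w t := by
        have h0 := ha0 t
        simp only [hw]
        field_simp
        simp only [ha]
        field_simp
        ring_nf
        simp only [I_sq]
        ring
      rw [← Complex.exp_add, div_eq_mul_inv _ (a t), this]; congr 1; ring
    simp_rw [hl, hr]
    rw [hpoisson, hsqrt, mul_comm ((t : ℂ) ^ (1 / 2 : ℂ)) (_ ^ (1 / 2 : ℂ)), mul_assoc, mul_assoc,
      inv_mul_cancel_left₀ hq1]
    ring
  have hI : (1 - I : ℂ) ≠ 0 := fun h => by simpa using congrArg re h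
  have hsk : ((√k : ℝ) : ℂ) ≠ 0 := by
    exact_mod_cast (Real.sqrt_pos.mpr (by exact_mod_cast hk)).ne'
  have hmain := ((ha_sqrt.inv₀ (div_ne_zero hI hsk)).mul (hq_sqrt.inv₀ (by simp [hk0]))).mul hright
  have huniq := tendsto_nhds_unique hleft (hmain.congr' (by
    filter_upwards [self_mem_nhdsWithin] with t ht
    exact (hfun t ht).symm))
  have hpow : cexp (-Real.pi * (I * k / 2)) = (-I) ^ k := by
    rw [show -Real.pi * (I * k / 2) = k * (-(Real.pi / 2 * I)) by ring, Complex.exp_nat_mul,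
      Complex.exp_neg, Complex.exp_pi_div_two_mul_I, inv_I]
  simp only [Fin.sum_univ_two, Fin.val_zero, Fin.val_one, Nat.cast_zero, Nat.cast_one,
    Int.cast_natCast, one_pow, mul_one, hpow, Nat.cast_ofNat] at huniq
  rw [div_eq_iff hk0] at huniq
  rw [huniq]
  norm_num
  field_simp
  ring_nf
  simp only [I_sq]
  ring

theorem neg_I_pow_mod_four (n : ℕ) : (-I) ^ n = (-I) ^ (n % 4) := by
  have h4 : (-I) ^ 4 = 1 := by rw [Even.neg_pow (by decide), I_pow_four]
  conv_lhs => rw [← Nat.div_add_mod n 4, pow_add, pow_mul, h4, one_pow, one_mul]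

/-- The sign `1` or `I` of the quadratic Gauss sum of odd modulus `n`. -/
noncomputable def gaussSign (n : ℕ) : ℂ := (1 + I) / 2 * (1 + (-I) ^ n)

theorem gaussSign_of_mod_four_eq_one {n : ℕ} (hn : n % 4 = 1) : gaussSign n = 1 := by
  rw [gaussSign, neg_I_pow_mod_four, hn, pow_one]
  linear_combination (-1 / 2 : ℂ) * I_sq

theorem gaussSign_of_mod_four_eq_three {n : ℕ} (hn : n % 4 = 3) : gaussSign n = I := by
  rw [gaussSign, neg_I_pow_mod_four, hn]
  linear_combination (-(I ^ 2 + I - 1) / 2 : ℂ) * I_sq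

open NumberTheorySymbols in
/-- Quadratic reciprocity in terms of the signs of the Gauss sums. -/
theorem jacobiSym_mul_jacobiSym_mul_gaussSign {m n : ℕ} (hm : Odd m) (hn : Odd n)
    (hmn : m.Coprime n) :
    (J(n | m) * J(m | n) : ℂ) * (gaussSign m * gaussSign n) = gaussSign (m * n) := by
  have hsq : (J(n | m) : ℂ) * J(n | m) = 1 := by
    exact_mod_cast (sq J(n | m)).symm.trans (jacobiSym.sq_one (by simpa using hmn.symm))
  rcases Nat.odd_mod_four_iff.mp (Nat.odd_iff.mp hm) with h1 | h1 <;>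
  rcases Nat.odd_mod_four_iff.mp (Nat.odd_iff.mp hn) with h2 | h2
  · rw [jacobiSym.quadratic_reciprocity_one_mod_four h1 hn, hsq,
      gaussSign_of_mod_four_eq_one h1, gaussSign_of_mod_four_eq_one h2,
      gaussSign_of_mod_four_eq_one (by simp [Nat.mul_mod, h1, h2])]
    ring
  · rw [jacobiSym.quadratic_reciprocity_one_mod_four h1 hn, hsq,
      gaussSign_of_mod_four_eq_one h1, gaussSign_of_mod_four_eq_three h2,
      gaussSign_of_mod_four_eq_three (by simp [Nat.mul_mod, h1, h2])]
    ring
  · rw [← jacobiSym.quadratic_reciprocity_one_mod_four h2 hm, hsq,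
      gaussSign_of_mod_four_eq_three h1, gaussSign_of_mod_four_eq_one h2,
      gaussSign_of_mod_four_eq_three (by simp [Nat.mul_mod, h1, h2])]
    ring
  · rw [jacobiSym.quadratic_reciprocity_three_mod_four h1 h2,
      gaussSign_of_mod_four_eq_three h1, gaussSign_of_mod_four_eq_three h2,
      gaussSign_of_mod_four_eq_one (by simp [Nat.mul_mod, h1, h2]), Int.cast_neg]
    linear_combination hsq - (J(n | m) : ℂ) * J(n | m) * I_sq

theorem jacobiSym_val_intCast (n : ℕ) [NeZero n] (z : ℤ) :
    jacobiSym ((z : ZMod n).val : ℤ) n = jacobiSym z n := by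
  rw [ZMod.val_intCast, ← jacobiSym.mod_left]

theorem exp_val_intCast (n : ℕ) [NeZero n] (a z : ℤ) :
    cexp (2 * Real.pi * I * a * (z : ZMod n).val / n) = cexp (2 * Real.pi * I * a * z / n) := by
  have h1 := ZMod.stdAddChar_coe (N := n) (a * ((z : ZMod n).val : ℤ))
  have h2 := ZMod.stdAddChar_coe (N := n) (a * z)
  push_cast at h1 h2
  rw [mul_assoc _ (a : ℂ), mul_assoc _ (a : ℂ), ← h1, ← h2, ZMod.natCast_zmod_val]

/-- The Gauss sum of the Jacobi symbol modulo `n`, twisted by `a`. -/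
noncomputable def jacobiGaussSum (n : ℕ) [NeZero n] (a : ℤ) : ℂ :=
  ∑ t : ZMod n, (jacobiSym t.val n : ℂ) * cexp (2 * Real.pi * I * a * t.val / n)

theorem sum_zmod_mul {m n : ℕ} [NeZero m] [NeZero n] (hmn : m.Coprime n) (f : ZMod (m * n) → ℂ) :
    ∑ t, f t = ∑ u : ZMod m, ∑ v : ZMod n, f ((n * u.val + m * v.val : ℤ) : ZMod (m * n)) := by
  rw [← Fintype.sum_prod_type']
  symm
  refine Fintype.sum_bijective _ ?_ _ _ fun _ => rfl
  rw [Fintype.bijective_iff_injective_and_card]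
  refine ⟨?_, by simp [ZMod.card]⟩
  rintro ⟨u, v⟩ ⟨u', v'⟩ h
  have hm := congrArg (ZMod.castHom (dvd_mul_right m n) (ZMod m)) h
  have hn := congrArg (ZMod.castHom (dvd_mul_left n m) (ZMod n)) h
  simp only [map_intCast] at hm hn
  push_cast at hm hn
  simp only [ZMod.natCast_zmod_val, CharP.cast_eq_zero, zero_mul, add_zero, zero_add] at hm hn
  have h1 : IsUnit (n : ZMod m) := (ZMod.isUnit_iff_coprime n m).mpr hmn.symm
  have h2 : IsUnit (m : ZMod n) := (ZMod.isUnit_iff_coprime m n).mpr hmn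
  rw [h1.mul_right_inj] at hm
  rw [h2.mul_right_inj] at hn
  rw [hm, hn]

theorem jacobiGaussSum_mul {m n : ℕ} [NeZero m] [NeZero n] (hmn : m.Coprime n) (a : ℤ) :
    jacobiGaussSum (m * n) a =
      (jacobiSym n m * jacobiSym m n : ℂ) * (jacobiGaussSum m a * jacobiGaussSum n a) := by
  have hm0 : (m : ℂ) ≠ 0 := NeZero.ne _
  have hn0 : (n : ℂ) ≠ 0 := NeZero.ne _
  rw [jacobiGaussSum, sum_zmod_mul hmn]
  simp_rw [jacobiSym_val_intCast, exp_val_intCast]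
  rw [jacobiGaussSum, jacobiGaussSum, Finset.sum_mul_sum, Finset.mul_sum]
  refine Finset.sum_congr rfl fun u _ => ?_
  rw [Finset.mul_sum]
  refine Finset.sum_congr rfl fun v _ => ?_
  have hexp : cexp (2 * Real.pi * I * a * ((n * u.val + m * v.val : ℤ) : ℂ) / ((m * n : ℕ) : ℂ)) =
      cexp (2 * Real.pi * I * a * u.val / m) * cexp (2 * Real.pi * I * a * v.val / n) := by
    rw [← Complex.exp_add]
    congr 1
    push_cast
    field_simp
  have hm : jacobiSym (n * u.val + m * v.val) m = jacobiSym n m * jacobiSym u.val m := by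
    rw [← jacobiSym.mul_left]
    exact jacobiSym.mod_left' (by simp)
  have hn : jacobiSym (n * u.val + m * v.val) n = jacobiSym m n * jacobiSym v.val n := by
    rw [← jacobiSym.mul_left]
    exact jacobiSym.mod_left' (by simp)
  rw [hexp, jacobiSym.mul_right, hm, hn]
  push_cast
  ring

theorem Fin.bijective_natCast_zmod (n : ℕ) [NeZero n] :
    Function.Bijective (fun r : Fin n => ((r : ℕ) : ZMod n)) := by
  rw [Fintype.bijective_iff_injective_and_card]
  refine ⟨fun r s h => ?_, by simp [ZMod.card]⟩
  have := congrArg ZMod.val h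
  simp only [ZMod.val_cast_of_lt r.2, ZMod.val_cast_of_lt s.2] at this
  exact Fin.ext this

theorem sum_stdAddChar_sq (n : ℕ) [NeZero n] :
    ∑ x : ZMod n, ZMod.stdAddChar (x ^ 2) = √n * gaussSign n := by
  rw [gaussSign, ← mul_assoc, ← sum_exp_sq (NeZero.pos n)]
  symm
  refine Fintype.sum_bijective _ (Fin.bijective_natCast_zmod n) _ _ fun r => ?_
  have := ZMod.stdAddChar_coe (N := n) ((r : ℕ) ^ 2 : ℤ)
  push_cast at this
  exact this.symm

theorem jacobiGaussSum_prime {p : ℕ} [hp : Fact p.Prime] (hp2 : p ≠ 2) (a : ℤ) :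
    jacobiGaussSum p a = jacobiSym a p * (√p * gaussSign p) := by
  have hchar : ringChar (ZMod p) ≠ 2 := by rwa [ZMod.ringChar_zmod_n]
  set χ : MulChar (ZMod p) ℂ := (quadraticChar (ZMod p)).ringHomComp (Int.castRingHom ℂ) with hχ
  have hχ_apply : ∀ z : ℤ, χ z = jacobiSym z p := fun z => by
    rw [← jacobiSym.legendreSym.to_jacobiSym, legendreSym, hχ, MulChar.ringHomComp_apply]
    simp
  have hχ1 : χ ≠ 1 := by
    obtain ⟨x, hx⟩ := quadraticChar_exists_neg_one hchar
    intro h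
    have hx0 : x ≠ 0 := by rintro rfl; simp at hx
    have := congrArg (fun c : MulChar (ZMod p) ℂ => c x) h
    simp only [hχ, MulChar.ringHomComp_apply, hx, MulChar.one_apply (isUnit_iff_ne_zero.mpr hx0)]
      at this
    norm_num at this
  have hgauss : gaussSum χ ZMod.stdAddChar = √p * gaussSign p := by
    rw [← sum_stdAddChar_sq]
    have hzero : ∑ t : ZMod p, ZMod.stdAddChar t = 0 :=
      AddChar.sum_eq_zero_of_ne_one (by
        simpa using (ZMod.isPrimitive_stdAddChar p) one_ne_zero)
    calc gaussSum χ ZMod.stdAddChar = ∑ t : ZMod p, (χ t + 1) * ZMod.stdAddChar t := by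
          simp_rw [add_mul, one_mul]
          rw [Finset.sum_add_distrib, hzero, add_zero, gaussSum]
      _ = ∑ t : ZMod p, ∑ x : ZMod p with x ^ 2 = t, ZMod.stdAddChar (x ^ 2) := by
          refine Finset.sum_congr rfl fun t _ => ?_
          rw [Finset.sum_congr rfl (g := fun _ => ZMod.stdAddChar t) (by simp +contextual),
            Finset.sum_const, nsmul_eq_mul]
          congr 1
          have := quadraticChar_card_sqrts hchar t
          rw [hχ, MulChar.ringHomComp_apply, eq_intCast]
          have h2 : ({x : ZMod p | x ^ 2 = t} : Finset (ZMod p)) =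
            ({x : ZMod p | x ^ 2 = t} : Set (ZMod p)).toFinset := by ext; simp
          rw [h2]
          exact_mod_cast congrArg (Int.cast (R := ℂ)) this.symm
      _ = _ := Finset.sum_fiberwise _ _ _
  have hshift : jacobiGaussSum p a = gaussSum χ (ZMod.stdAddChar.mulShift (a : ZMod p)) := by
    refine Finset.sum_congr rfl fun t _ => ?_
    have h1 := ZMod.stdAddChar_coe (N := p) (a * (t.val : ℤ))
    have h2 := hχ_apply t.val
    push_cast [ZMod.natCast_zmod_val] at h1 h2
    rw [AddChar.mulShift_apply, h1, h2, mul_assoc _ (a : ℂ)]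
  rw [hshift, ← hχ_apply]
  by_cases ha : (a : ZMod p) = 0
  · rw [ha, AddChar.mulShift_zero, gaussSum_one_right hχ1, MulChar.map_zero, zero_mul]
  · have h := gaussSum_mulShift χ ZMod.stdAddChar (Units.mk0 _ ha)
    rw [Units.val_mk0] at h
    have hsq : χ a * χ a = 1 := by
      have := quadraticChar_sq_one ha
      rw [hχ, MulChar.ringHomComp_apply, eq_intCast, ← sq]
      exact_mod_cast this
    rw [← hgauss, ← h, ← mul_assoc, hsq, one_mul]

/-- The Gauss sum of the Jacobi symbol of odd squarefree modulus, including its sign. -/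
theorem jacobiGaussSum_eq {n : ℕ} [inst : NeZero n] (hn : Odd n) (hsf : Squarefree n) (a : ℤ) :
    jacobiGaussSum n a = jacobiSym a n * (√n * gaussSign n) := by
  revert inst
  induction n using induction_on_primes with
  | zero => simp at hn
  | one =>
    intro
    have : Subsingleton (ZMod 1) := inferInstanceAs (Subsingleton (Fin 1))
    rw [jacobiGaussSum, Fintype.sum_subsingleton _ 0, gaussSign_of_mod_four_eq_one rfl]
    simp
  | prime_mul p n hp ih =>
    intro
    obtain ⟨hpn, -, hsfn⟩ := Nat.squarefree_mul_iff.mp hsf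
    obtain ⟨hpo, hno⟩ := Nat.odd_mul.mp hn
    have : NeZero n := ⟨by rintro rfl; simp at hno⟩
    have : Fact p.Prime := ⟨hp⟩
    have hp2 : p ≠ 2 := by rintro rfl; exact absurd hpo (by decide)
    rw [jacobiGaussSum_mul hpn, jacobiGaussSum_prime hp2, ih hno hsfn,
      ← jacobiSym_mul_jacobiSym_mul_gaussSign hpo hno hpn, jacobiSym.mul_right, Nat.cast_mul,
      Real.sqrt_mul (by positivity)]
    push_cast
    ring

/-- The half-range sine sum: the Jacobi symbol vector is fixed by the sine transform. -/
theorem two_mul_sum_sin_mul_jacobiSym {N p : ℕ} (hp : p = 2 * N + 1) (hsf : Squarefree p)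
    (hmod : p % 4 = 3) (a : ℤ) :
    2 * ∑ x : Fin N, Real.sin (2 * Real.pi * a * ((x : ℕ) + 1) / p) *
      (jacobiSym ((x : ℕ) + 1) p : ℝ) = √p * jacobiSym a p := by
  have : NeZero p := ⟨by omega⟩
  have hp0 : (p : ℝ) ≠ 0 := NeZero.ne _
  have hodd : Odd p := ⟨N, hp⟩
  have h := congrArg im (jacobiGaussSum_eq hodd hsf a)
  set F : ℕ → ℝ := fun t => Real.sin (2 * Real.pi * a * t / p) * (jacobiSym t p : ℝ) with hF
  have hsum : (jacobiGaussSum p a).im = ∑ t ∈ Finset.range p, F t := by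
    rw [jacobiGaussSum, im_sum, ← Fin.sum_univ_eq_sum_range]
    symm
    refine Fintype.sum_bijective _ (Fin.bijective_natCast_zmod p) _ _ fun r => ?_
    rw [ZMod.val_cast_of_lt r.2, ← ofReal_intCast, im_ofReal_mul,
      show 2 * Real.pi * I * a * (r : ℕ) / p =
        ((2 * Real.pi * a * (r : ℕ) / p : ℝ) : ℂ) * I by push_cast; ring,
      exp_ofReal_mul_I_im]
    exact mul_comm _ _
  have hrefl : ∀ t, t ≤ p → F (p - t) = F t := fun t ht => by
    simp only [hF]
    have h1 : jacobiSym ((p - t : ℕ) : ℤ) p = -jacobiSym t p := by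
      rw [← neg_one_mul, ← ZMod.χ₄_nat_three_mod_four hmod, ← jacobiSym.neg _ hodd]
      refine jacobiSym.mod_left' ?_
      rw [Nat.cast_sub ht]
      simp [sub_eq_add_neg]
    have h2 : Real.sin (2 * Real.pi * a * ((p - t : ℕ) : ℝ) / p) =
        -Real.sin (2 * Real.pi * a * t / p) := by
      rw [← Real.sin_neg, ← Real.sin_add_int_mul_two_pi (-_) a, Nat.cast_sub ht]
      congr 1
      field_simp
      ring
    rw [h1, h2]
    push_cast
    ring
  have hF0 : F 0 = 0 := by simp [hF]
  have hhalf : ∑ t ∈ Finset.range p, F t = 2 * ∑ x ∈ Finset.range N, F (x + 1) := by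
    rw [hp, Finset.sum_range_succ', hF0, add_zero, two_mul N, Finset.sum_range_add, two_mul]
    congr 1
    rw [← Finset.sum_range_reflect]
    refine Finset.sum_congr rfl fun x hx => ?_
    have := Finset.mem_range.mp hx
    rw [← hrefl (x + 1) (by omega)]
    congr 1
    omega
  rw [hsum, hhalf, gaussSign_of_mod_four_eq_three hmod, ← Fin.sum_univ_eq_sum_range
    (fun x => F (x + 1))] at h
  rw [← ofReal_intCast, im_ofReal_mul, im_ofReal_mul, I_im, mul_one, mul_comm (_ : ℝ) (√p)] at h
  rw [← h]
  simp [hF]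

theorem stmt_5 (N : ℕ) (hN : 1 ≤ N) (p : ℕ) (hp : p = 2 * N + 1)
    (hsf : Squarefree p) (hmod : p % 4 = 3)
    (J : Matrix (Fin N) (Fin N) ℝ)
    (hJ : ∀ k x : Fin N, J k x =
      (2 / Real.sqrt p) * Real.sin (2 * Real.pi * ((k : ℕ) + 1) * ((x : ℕ) + 1) / p))
    (ψ : Fin N → ℝ)
    (hψ : ∀ x : Fin N, ψ x = ((jacobiSym ((x : ℕ) + 1 : ℤ) p : ℤ) : ℝ))
    (σ : Fin N → ℝ) (hσ : ∀ x, σ x = 1 ∨ σ x = -1)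
    (hagree : ∀ x, ψ x ≠ 0 → σ x = ψ x)
    (h : ℕ) (hh : h = (Finset.univ.filter (fun x : Fin N => ψ x = 0)).card) :
    -(1 / 2) * (∑ i : Fin N, ∑ j : Fin N, J i j * σ i * σ j)
      ≤ -((N : ℝ) - h) / 2 + h * Real.sqrt h := by
  have hp_pos : (0 : ℝ) < p := by exact_mod_cast (by omega : 0 < p)
  have hsp : 0 < √(p : ℝ) := Real.sqrt_pos.mpr hp_pos
  have hsymm : ∀ i j, J i j = J j i := fun i j => by rw [hJ, hJ]; ring_nf
  have heig : ∀ i, ∑ j, J i j * ψ j = ψ i := fun i => by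
    have := two_mul_sum_sin_mul_jacobiSym hp hsf hmod ((i : ℕ) + 1)
    push_cast at this
    simp_rw [hJ, hψ, mul_assoc (2 / √(p : ℝ))]
    rw [← Finset.mul_sum, div_mul_eq_mul_div, this, mul_div_cancel_left₀ _ hsp.ne']
  set v : Fin N → ℝ := fun x => if ψ x = 0 then σ x else 0 with hv
  have hσv : ∀ x, σ x = ψ x + v x := fun x => by
    by_cases hx : ψ x = 0
    · simp [hv, hx]
    · simp [hv, hx, hagree x hx]
  have hψv : ∀ x, ψ x * v x = 0 := fun x => by
    by_cases hx : ψ x = 0 <;> simp [hv, hx]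
  have hvabs : ∀ x, |v x| = if ψ x = 0 then 1 else 0 := fun x => by
    by_cases hx : ψ x = 0
    · rcases hσ x with h1 | h1 <;> simp [hv, hx, h1]
    · simp [hv, hx]
  have hψsq : ∀ x, ψ x * ψ x = 1 - if ψ x = 0 then 1 else 0 := fun x => by
    by_cases hx : ψ x = 0
    · simp [hx]
    · rw [← hagree x hx, if_neg (by rwa [hagree x hx])]
      rcases hσ x with h1 | h1 <;> simp [h1]
  have hcard : ∑ x, (if ψ x = 0 then (1 : ℝ) else 0) = h := by simp [hh]
  have hexpand : ∑ i, ∑ j, J i j * σ i * σ j =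
      ((N : ℝ) - h) + ∑ i, ∑ j, J i j * v i * v j := by
    have h1 : ∑ i, ∑ j, J i j * ψ j * (ψ i + v i) = (N : ℝ) - h := by
      simp_rw [← Finset.sum_mul, heig, mul_add, hψv, add_zero, hψsq]
      rw [Finset.sum_sub_distrib, hcard]
      simp
    have h2 : ∑ i, ∑ j, J i j * ψ i * v j = 0 := by
      rw [Finset.sum_comm]
      refine Finset.sum_eq_zero fun j _ => ?_
      rw [← Finset.sum_mul, Finset.sum_congr rfl fun i _ => by rw [hsymm i j], heig, hψv]
    have h3 : ∀ i j, J i j * σ i * σ j =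
        J i j * ψ j * (ψ i + v i) + J i j * ψ i * v j + J i j * v i * v j := fun i j => by
      rw [hσv, hσv]; ring
    simp_rw [h3, Finset.sum_add_distrib]
    rw [h1, h2, add_zero]
  have hJabs : ∀ i j, |J i j| ≤ 2 / √(p : ℝ) := fun i j => by
    rw [hJ, abs_mul, abs_of_pos (by positivity)]
    exact mul_le_of_le_one_right (by positivity) (Real.abs_sin_le_one _)
  have hvv : |∑ i, ∑ j, J i j * v i * v j| ≤ 2 / √(p : ℝ) * (h * h) := by
    rw [← hcard, Finset.sum_mul_sum, Finset.mul_sum]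
    refine (Finset.abs_sum_le_sum_abs _ _).trans (Finset.sum_le_sum fun i _ => ?_)
    rw [Finset.mul_sum]
    refine (Finset.abs_sum_le_sum_abs _ _).trans (Finset.sum_le_sum fun j _ => ?_)
    rw [abs_mul, abs_mul, mul_assoc, ← hvabs, ← hvabs]
    exact mul_le_mul_of_nonneg_right (hJabs i j) (by positivity)
  have hhp : √(h : ℝ) ≤ √(p : ℝ) := by
    refine Real.sqrt_le_sqrt (Nat.cast_le.mpr ?_)
    have := Finset.card_filter_le (Finset.univ : Finset (Fin N)) (fun x => ψ x = 0)
    rw [← hh, Finset.card_univ, Fintype.card_fin] at this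
    omega
  have hbound : (h * h : ℝ) / √(p : ℝ) ≤ h * √(h : ℝ) := by
    rw [div_le_iff₀ hsp, mul_assoc]
    refine mul_le_mul_of_nonneg_left ?_ (by positivity)
    nlinarith [Real.mul_self_sqrt (Nat.cast_nonneg (α := ℝ) h), Real.sqrt_nonneg (h : ℝ)]
  rw [hexpand]
  have := (abs_le.mp hvv).1
  have h2 : 2 / √(p : ℝ) * (h * h) = 2 * ((h * h : ℝ) / √(p : ℝ)) := by ring
  linarith
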